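/- arXiv:1811.10977 — 4 statements merged into one kernel-verified Lean document; each statement's English description precedes it below -/
import Mathlib

section
/- For every condition p ∈ P, every n ∈ ℕ, and all distinct k, k' ∈ ℕ, there exists π ∈ 𝒢 such that π*ₙ is the transposition exchanging k and k', π*ⱼ = id for every j ≠ n, and πp is compatible with p. (This can be arranged by choosing α < κ above sup{β : (n,k,β) or (n,k',β) occurs in a first-three-coordinates-plus-fourth-coordinate pair of dom p} and letting both π(n,k,·) and π(n,k',·) be the permutation of κ switching the intervals [0,α) and [α,α+α).) -/
/-!
Context: κ is an infinite regular cardinal, represented by a type `K`.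
Conditions of `P = Add(κ, ω×ω×κ)` are functional sets of pairs `((n,m,α,β), b)`
with domain of size `< κ`, ordered by reverse inclusion.  `𝒢` is the group of
permutations of `ℕ × ℕ × κ` preserving the first coordinate and mapping each
block `{n}×{m}×κ` onto a block `{n}×{m'}×κ`, acting on conditions by
`(πp)(π(n,m,α),β) = p(n,m,α,β)`.  `π*ₙ` is the induced permutation of `ℕ`
describing how `π` moves the blocks of `n`.
-/

/-- `p` is a condition in the Cohen poset `Add(κ, ω×ω×κ)`. -/
def IsCohenCond (K : Type*) (p : Set ((ℕ × ℕ × K × K) × Bool)) : Prop :=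
  (∀ x b b', (x, b) ∈ p → (x, b') ∈ p → b = b') ∧
    Cardinal.mk ↥(Prod.fst '' p) < Cardinal.mk K

/-- The block `{n}×{m}×κ` inside `ℕ × ℕ × κ`. -/
def cohenBlock (K : Type*) (n m : ℕ) : Set (ℕ × ℕ × K) :=
  {y | y.1 = n ∧ y.2.1 = m}

/-- Membership in the group `𝒢`. -/
def InCohenG (K : Type*) (π : Equiv.Perm (ℕ × ℕ × K)) : Prop :=
  (∀ y : ℕ × ℕ × K, (π y).1 = y.1) ∧
    ∀ n m : ℕ, ∃ m' : ℕ, π '' cohenBlock K n m = cohenBlock K n m'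

/-- The action of a permutation of `ℕ × ℕ × κ` on (graphs of) conditions. -/
def cohenAct {K : Type*} (π : Equiv.Perm (ℕ × ℕ × K))
    (p : Set ((ℕ × ℕ × K × K) × Bool)) : Set ((ℕ × ℕ × K × K) × Bool) :=
  (fun cb : (ℕ × ℕ × K × K) × Bool =>
    (((π (cb.1.1, cb.1.2.1, cb.1.2.2.1)).1,
      (π (cb.1.1, cb.1.2.1, cb.1.2.2.1)).2.1,
      (π (cb.1.1, cb.1.2.1, cb.1.2.2.1)).2.2,
      cb.1.2.2.2), cb.2)) '' p

/-- A set of size less than `κ` can be moved off itself by a permutation of `κ`. -/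
theorem exists_perm_apply_notMem {K : Type*} [Infinite K] (A : Set K)
    (hA : Cardinal.mk A < Cardinal.mk K) :
    ∃ σ : Equiv.Perm K, ∀ a ∈ A, σ a ∉ A := by
  have hcompl : Cardinal.mk (Aᶜ : Set K) = Cardinal.mk K := Cardinal.mk_compl_of_infinite A hA
  obtain ⟨f⟩ : Nonempty (A ↪ (Aᶜ : Set K)) :=
    Cardinal.le_def _ _ |>.1 (hcompl ▸ hA.le)
  obtain ⟨g, hg⟩ := Cardinal.extend_function_of_lt
    (f.trans (Function.Embedding.subtype (· ∈ Aᶜ))) hA ⟨Equiv.refl K⟩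
  refine ⟨g, fun a ha => ?_⟩
  have := hg ⟨a, ha⟩
  simp only [Function.Embedding.trans_apply, Function.Embedding.subtype_apply] at this
  rw [this]
  exact (f ⟨a, ha⟩).2

/-- The permutation sending `(j, m, a)` to `(j, τ j m, s j m a)`. -/
def blockPerm {K : Type*} (τ : ℕ → Equiv.Perm ℕ) (s : ℕ → ℕ → Equiv.Perm K) :
    Equiv.Perm (ℕ × ℕ × K) :=
  Equiv.prodShear (Equiv.refl ℕ) fun j => Equiv.prodShear (τ j) (s j)

@[simp]
theorem blockPerm_apply {K : Type*} (τ : ℕ → Equiv.Perm ℕ) (s : ℕ → ℕ → Equiv.Perm K)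
    (j m : ℕ) (a : K) : blockPerm τ s (j, m, a) = (j, τ j m, s j m a) := rfl

theorem blockPerm_image_cohenBlock {K : Type*} (τ : ℕ → Equiv.Perm ℕ)
    (s : ℕ → ℕ → Equiv.Perm K) (j m : ℕ) :
    blockPerm τ s '' cohenBlock K j m = cohenBlock K j (τ j m) := by
  ext ⟨j', m', a⟩
  constructor
  · rintro ⟨⟨i, l, b⟩, ⟨rfl, rfl⟩, h⟩
    simp only [blockPerm_apply, Prod.mk.injEq] at h
    exact ⟨h.1.symm, h.2.1.symm⟩
  · rintro ⟨hj, hm⟩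
    obtain rfl : j' = j := hj
    obtain rfl : m' = τ j' m := hm
    exact ⟨(j', m, (s j' m).symm a), ⟨rfl, rfl⟩, by simp⟩

theorem inCohenG_blockPerm {K : Type*} (τ : ℕ → Equiv.Perm ℕ)
    (s : ℕ → ℕ → Equiv.Perm K) : InCohenG K (blockPerm τ s) :=
  ⟨fun _ => rfl, fun j m => ⟨τ j m, blockPerm_image_cohenBlock τ s j m⟩⟩

theorem mem_cohenAct_blockPerm {K : Type*} {τ : ℕ → Equiv.Perm ℕ}
    {s : ℕ → ℕ → Equiv.Perm K} {p : Set ((ℕ × ℕ × K × K) × Bool)}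
    {x : ℕ × ℕ × K × K} {b : Bool} :
    (x, b) ∈ cohenAct (blockPerm τ s) p ↔
      ∃ j m a c, ((j, m, a, c), b) ∈ p ∧ (j, τ j m, s j m a, c) = x := by
  constructor
  · rintro ⟨⟨⟨j, m, a, c⟩, b'⟩, hp, h⟩
    obtain ⟨hx, rfl⟩ := Prod.mk.inj h
    exact ⟨j, m, a, c, hp, hx⟩
  · rintro ⟨j, m, a, c, hp, rfl⟩
    exact ⟨_, hp, rfl⟩

theorem mk_fst_image_cohenAct_le {K : Type*} (π : Equiv.Perm (ℕ × ℕ × K))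
    (p : Set ((ℕ × ℕ × K × K) × Bool)) :
    Cardinal.mk ↥(Prod.fst '' cohenAct π p) ≤ Cardinal.mk ↥(Prod.fst '' p) := by
  have h : Prod.fst '' cohenAct π p =
      (fun c : ℕ × ℕ × K × K => ((π (c.1, c.2.1, c.2.2.1)).1, (π (c.1, c.2.1, c.2.2.1)).2.1,
        (π (c.1, c.2.1, c.2.2.1)).2.2, c.2.2.2)) '' (Prod.fst '' p) := by
    simp only [cohenAct, Set.image_image]
  rw [h]
  exact Cardinal.mk_image_le

theorem isCohenCond_cohenAct_blockPerm {K : Type*} (τ : ℕ → Equiv.Perm ℕ)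
    (s : ℕ → ℕ → Equiv.Perm K) {p : Set ((ℕ × ℕ × K × K) × Bool)} (hp : IsCohenCond K p) :
    IsCohenCond K (cohenAct (blockPerm τ s) p) := by
  refine ⟨fun x b b' h h' => ?_, (mk_fst_image_cohenAct_le _ _).trans_lt hp.2⟩
  obtain ⟨j, m, a, c, hb, rfl⟩ := mem_cohenAct_blockPerm.1 h
  obtain ⟨j', m', a', c', hb', hx⟩ := mem_cohenAct_blockPerm.1 h'
  simp only [Prod.mk.injEq] at hx
  obtain ⟨rfl, hm, ha, rfl⟩ := hx
  obtain rfl := (τ j').injective hm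
  obtain rfl := (s j' m').injective ha
  exact hp.1 _ _ _ hb hb'

theorem IsCohenCond.union {K : Type*} [Infinite K] {p q : Set ((ℕ × ℕ × K × K) × Bool)}
    (hp : IsCohenCond K p) (hq : IsCohenCond K q)
    (hpq : ∀ x b b', (x, b) ∈ p → (x, b') ∈ q → b = b') : IsCohenCond K (p ∪ q) := by
  refine ⟨?_, ?_⟩
  · rintro x b b' (h | h) (h' | h')
    · exact hp.1 x b b' h h'
    · exact hpq x b b' h h'
    · exact (hpq x b' b h' h).symm
    · exact hq.1 x b b' h h'
  · rw [Set.image_union]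
    exact (Cardinal.mk_union_le _ _).trans_lt
      (Cardinal.add_lt_of_lt (Cardinal.aleph0_le_mk K) hp.2 hq.2)

/-- for every condition `p`, every `n` and distinct `k, k'`, there
is `π ∈ 𝒢` whose induced permutation `π*ₙ` is the transposition exchanging `k`
and `k'` (it swaps the blocks `{n}×{k}×κ` and `{n}×{k'}×κ` and maps every
other block of `n` onto itself), with `π*ⱼ = id` for all `j ≠ n`, such that
`πp` is compatible with `p`. -/
theorem cohenG_swap_compatible (K : Type*) (hK : (Cardinal.mk K).IsRegular)
    (p : Set ((ℕ × ℕ × K × K) × Bool)) (hp : IsCohenCond K p)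
    (n k k' : ℕ) (hkk' : k ≠ k') :
    ∃ π : Equiv.Perm (ℕ × ℕ × K), InCohenG K π ∧
      π '' cohenBlock K n k = cohenBlock K n k' ∧
      π '' cohenBlock K n k' = cohenBlock K n k ∧
      (∀ m : ℕ, m ≠ k → m ≠ k' → π '' cohenBlock K n m = cohenBlock K n m) ∧
      (∀ j : ℕ, j ≠ n → ∀ m : ℕ, π '' cohenBlock K j m = cohenBlock K j m) ∧
      ∃ r, IsCohenCond K r ∧ cohenAct π p ⊆ r ∧ p ⊆ r := by
  have : Infinite K := Cardinal.infinite_iff.2 hK.aleph0_le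
  let A : Set K := (fun c : ℕ × ℕ × K × K => c.2.2.1) '' (Prod.fst '' p)
  have hA {j m : ℕ} {a c : K} {b : Bool} (h : ((j, m, a, c), b) ∈ p) : a ∈ A :=
    ⟨_, ⟨_, h, rfl⟩, rfl⟩
  obtain ⟨σ, hσ⟩ := exists_perm_apply_notMem A (Cardinal.mk_image_le.trans_lt hp.2)
  let τ : ℕ → Equiv.Perm ℕ := fun j => if j = n then Equiv.swap k k' else 1
  let s : ℕ → ℕ → Equiv.Perm K := fun j m => if j = n ∧ (m = k ∨ m = k') then σ else 1
  refine ⟨blockPerm τ s, inCohenG_blockPerm τ s, ?_, ?_, fun m hm hm' => ?_,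
    fun j hj m => ?_, cohenAct (blockPerm τ s) p ∪ p, ?_,
    Set.subset_union_left, Set.subset_union_right⟩
  · simp [blockPerm_image_cohenBlock, τ]
  · simp [blockPerm_image_cohenBlock, τ]
  · simp [blockPerm_image_cohenBlock, τ, Equiv.swap_apply_of_ne_of_ne hm hm']
  · simp [blockPerm_image_cohenBlock, τ, hj]
  refine (isCohenCond_cohenAct_blockPerm τ s hp).union hp fun x b b' h h' => ?_
  obtain ⟨j, m, a, c, hb, rfl⟩ := mem_cohenAct_blockPerm.1 h
  by_cases hjm : j = n ∧ (m = k ∨ m = k')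
  · have hs : s j m = σ := if_pos hjm
    exact absurd (hs ▸ hA h') (hσ a (hA hb))
  · have hs : s j m = 1 := if_neg hjm
    have hτ : τ j m = m := by
      by_cases hj : j = n
      · have hm : m ≠ k ∧ m ≠ k' := by tauto
        simp [τ, hj, Equiv.swap_apply_of_ne_of_ne hm.1 hm.2]
      · simp [τ, hj]
    rw [hs, hτ] at h'
    exact hp.1 _ _ _ hb h'
end

section
/- If ⟨t, f⟩ and ⟨t, g⟩ are two conditions in Q with the same first coordinate t, then they are compatible; indeed ⟨t, h⟩, where h(a) = min(f(a), g(a)) for a ⊆ supp(t), is a condition in Q extending both. -/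
/-!
Context: `(Aₙ)` is a family of pairwise disjoint countably infinite sets, `T`
is the set of finite choice sequences through the `Aₙ` (modelled as lists),
and `Q` is the poset of pairs `⟨t, f⟩` where `t : κ×ℕ → T` has finite support
and `f` (modelled as a total function `Set (κ×ℕ) → ℕ`, only its values on
subsets of the support being relevant) is ⊆-nondecreasing on subsets of the
support with `t↾a` being `f(a)`-injective for each `a ⊆ supp(t)`;
`⟨t, f⟩ ≤ ⟨s, g⟩` iff `supp(s) ⊆ supp(t)`, `s_x ⊆ t_x` on `supp(s)` and
`f ≤ g` on subsets of `supp(s)`.  Two conditions are compatible if they have a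
common extension in `Q`.
-/

variable {α : Type*} {K : Type*}

/-- `l` is a finite choice sequence through the family `A`. -/
def IsChoiceSeq (A : ℕ → Set α) (l : List α) : Prop :=
  ∀ k (h : k < l.length), l[k]'h ∈ A k

/-- The support of `t : κ×ℕ → T`. -/
def qsupp (t : K × ℕ → List α) : Set (K × ℕ) := {x | t x ≠ []}

/-- The family `t↾a` is `m`-injective. -/
def MInj (t : K × ℕ → List α) (a : Set (K × ℕ)) (m : ℕ) : Prop :=
  ∀ j, m < j → ∀ x ∈ a, ∀ y ∈ a, x ≠ y →
    ∀ (hx : j < (t x).length) (hy : j < (t y).length), (t x)[j]'hx ≠ (t y)[j]'hy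

/-- `⟨t, f⟩` is a condition in the poset `Q`. -/
def IsQCond (A : ℕ → Set α) (t : K × ℕ → List α) (f : Set (K × ℕ) → ℕ) : Prop :=
  (∀ x, IsChoiceSeq A (t x)) ∧ (qsupp t).Finite ∧
    (∀ a b : Set (K × ℕ), a ⊆ b → b ⊆ qsupp t → f a ≤ f b) ∧
    ∀ a ⊆ qsupp t, MInj t a (f a)

/-- The order on `Q`: `⟨t, f⟩ ≤ ⟨s, g⟩`. -/
def QLe (t : K × ℕ → List α) (f : Set (K × ℕ) → ℕ)
    (s : K × ℕ → List α) (g : Set (K × ℕ) → ℕ) : Prop :=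
  qsupp s ⊆ qsupp t ∧ (∀ x ∈ qsupp s, s x <+: t x) ∧
    ∀ a ⊆ qsupp s, f a ≤ g a

/-- two conditions `⟨t, f⟩` and `⟨t, g⟩` with the same first
coordinate are compatible: `⟨t, min(f,g)⟩` is a condition extending both. -/
theorem qcond_same_tree_compatible (A : ℕ → Set α) (K : Type*)
    (hd : Pairwise fun i j => Disjoint (A i) (A j))
    (hA : ∀ n, (A n).Countable ∧ (A n).Infinite)
    (t : K × ℕ → List α) (f g : Set (K × ℕ) → ℕ)
    (hf : IsQCond A t f) (hg : IsQCond A t g) :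
    IsQCond A t (fun a => min (f a) (g a)) ∧
      QLe t (fun a => min (f a) (g a)) t f ∧
      QLe t (fun a => min (f a) (g a)) t g := by
  obtain ⟨hc, hfin, hfm, hfi⟩ := hf
  obtain ⟨-, -, hgm, hgi⟩ := hg
  refine ⟨⟨hc, hfin, fun a b hab hb => min_le_min (hfm a b hab hb) (hgm a b hab hb), ?_⟩,
    ⟨subset_rfl, fun x _ => List.prefix_rfl, fun a _ => min_le_left _ _⟩,
    ⟨subset_rfl, fun x _ => List.prefix_rfl, fun a _ => min_le_right _ _⟩⟩
  intro a ha j hj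
  rcases min_lt_iff.mp hj with h | h
  · exact hfi a ha j h
  · exact hgi a ha j h
end

section
/- If ⟨t, f⟩ and ⟨s, g⟩ are conditions in Q with disjoint supports, supp(t) ∩ supp(s) = ∅, then they are compatible in Q: there is a condition ⟨u, h⟩ with u agreeing with t on supp(t) and with s on supp(s), h(a) = f(a) for a ⊆ supp(t), h(a) = g(a) for a ⊆ supp(s), and h suitably defined (⊆-nondecreasing, witnessing injectivity) on the remaining subsets of supp(t) ∪ supp(s), such that ⟨u, h⟩ ≤ ⟨t, f⟩ and ⟨u, h⟩ ≤ ⟨s, g⟩. -/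
/-!
Context: `(Aₙ)` is a family of pairwise disjoint countably infinite sets, `T`
is the set of finite choice sequences through the `Aₙ` (modelled as lists),
and `Q` is the poset of pairs `⟨t, f⟩` where `t : κ×ℕ → T` has finite support
and `f` (modelled as a total function `Set (κ×ℕ) → ℕ`, only its values on
subsets of the support being relevant) is ⊆-nondecreasing on subsets of the
support with `t↾a` being `f(a)`-injective for each `a ⊆ supp(t)`;
`⟨t, f⟩ ≤ ⟨s, g⟩` iff `supp(s) ⊆ supp(t)`, `s_x ⊆ t_x` on `supp(s)` and
`f ≤ g` on subsets of `supp(s)`.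
-/

variable {α : Type*} {K : Type*}

/-- A family of lists of length at most `m` is `m`-injective. -/
lemma mInj_of_length_le {t : K × ℕ → List α} {a : Set (K × ℕ)} {m : ℕ}
    (h : ∀ x ∈ a, (t x).length ≤ m) : MInj t a m := fun _ hj x hx _ _ _ hjx _ =>
  absurd (hj.trans hjx) (h x hx).not_gt

/-- `m`-injectivity depends only on the restriction of the family to `a`. -/
lemma MInj.congr {t u : K × ℕ → List α} {a : Set (K × ℕ)} {m : ℕ}
    (h : MInj t a m) (hu : ∀ x ∈ a, u x = t x) : MInj u a m := by
  intro j hj x hx y hy hxy hjx hjy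
  simp only [hu x hx, hu y hy] at hjx hjy ⊢
  exact h j hj x hx y hy hxy hjx hjy

/-- two conditions with disjoint supports are compatible: there is
a condition `⟨u, h⟩` extending both, with `u` agreeing with `t` on `supp(t)`,
with `s` on `supp(s)` (and trivial elsewhere), and `h` agreeing with `f` on
(nonempty) subsets of `supp(t)` and with `g` on (nonempty) subsets of
`supp(s)`, suitably defined on the remaining subsets of `supp(t) ∪ supp(s)`. -/
theorem qcond_disjoint_support_compatible (A : ℕ → Set α) (K : Type*)
    (hd : Pairwise fun i j => Disjoint (A i) (A j))
    (hA : ∀ n, (A n).Countable ∧ (A n).Infinite)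
    (t s : K × ℕ → List α) (f g : Set (K × ℕ) → ℕ)
    (ht : IsQCond A t f) (hs : IsQCond A s g)
    (hdisj : Disjoint (qsupp t) (qsupp s)) :
    ∃ (u : K × ℕ → List α) (h : Set (K × ℕ) → ℕ),
      IsQCond A u h ∧
      (∀ x ∈ qsupp t, u x = t x) ∧
      (∀ x ∈ qsupp s, u x = s x) ∧
      (∀ x, x ∉ qsupp t ∪ qsupp s → u x = []) ∧
      (∀ a : Set (K × ℕ), a.Nonempty → a ⊆ qsupp t → h a = f a) ∧
      (∀ a : Set (K × ℕ), a.Nonempty → a ⊆ qsupp s → h a = g a) ∧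
      QLe u h t f ∧ QLe u h s g := by
  classical
  obtain ⟨htc, htf, htm, hti⟩ := ht
  obtain ⟨hsc, hsf, hsm, hsi⟩ := hs
  let u : K × ℕ → List α := fun x => if x ∈ qsupp t then t x else s x
  have hut : ∀ x ∈ qsupp t, u x = t x := fun x hx => if_pos hx
  have hus : ∀ x ∈ qsupp s, u x = s x := fun x hx =>
    if_neg (Set.disjoint_right.mp hdisj hx)
  have hun : ∀ x, x ∉ qsupp t ∪ qsupp s → u x = [] := by
    intro x hx
    simp only [Set.mem_union, not_or] at hx
    exact (if_neg hx.1).trans (not_not.mp hx.2)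
  have hsupp : qsupp u = qsupp t ∪ qsupp s := by
    ext x
    constructor
    · exact fun hx => by_contra fun hn => hx (hun x hn)
    · rintro (hx | hx)
      · exact fun h => hx ((hut x hx).symm.trans h)
      · exact fun h => hx ((hus x hx).symm.trans h)
  have hfin : (qsupp u).Finite := hsupp ▸ htf.union hsf
  obtain ⟨N, hN⟩ := (hfin.image fun x => (u x).length).bddAbove
  let M := N + f (qsupp t) + g (qsupp s)
  let h : Set (K × ℕ) → ℕ := fun a =>
    if a = ∅ then 0 else if a ⊆ qsupp t then f a else if a ⊆ qsupp s then g a else M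
  have hht : ∀ a : Set (K × ℕ), a.Nonempty → a ⊆ qsupp t → h a = f a := by
    intro a ha hat
    simp only [h, if_neg ha.ne_empty, if_pos hat]
  have hhs : ∀ a : Set (K × ℕ), a.Nonempty → a ⊆ qsupp s → h a = g a := by
    intro a ha has
    have hat : ¬ a ⊆ qsupp t := fun hat =>
      ha.elim fun x hx => Set.disjoint_left.mp hdisj (hat hx) (has hx)
    simp only [h, if_neg ha.ne_empty, if_neg hat, if_pos has]
  have hhM : ∀ a : Set (K × ℕ), ¬ a ⊆ qsupp t → ¬ a ⊆ qsupp s → h a = M := by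
    intro a hat has
    have ha : a ≠ ∅ := fun ha => hat (ha ▸ Set.empty_subset _)
    simp only [h, if_neg ha, if_neg hat, if_neg has]
  have hh0 : h ∅ = 0 := if_pos rfl
  have hle : ∀ a, h a ≤ M := by
    intro a
    rcases a.eq_empty_or_nonempty with rfl | ha
    · exact hh0 ▸ Nat.zero_le _
    by_cases hat : a ⊆ qsupp t
    · have := htm a _ hat subset_rfl
      rw [hht a ha hat]
      omega
    by_cases has : a ⊆ qsupp s
    · have := hsm a _ has subset_rfl
      rw [hhs a ha has]
      omega
    exact (hhM a hat has).le
  refine ⟨u, h, ⟨?_, hfin, ?_, ?_⟩, hut, hus, hun, hht, hhs, ⟨?_, ?_, ?_⟩, ?_, ?_, ?_⟩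
  · intro x
    by_cases hx : x ∈ qsupp t
    · exact (hut x hx).symm ▸ htc x
    · have hx' : u x = s x := if_neg hx
      exact hx' ▸ hsc x
  · intro a b hab _
    rcases a.eq_empty_or_nonempty with rfl | ha
    · exact hh0 ▸ Nat.zero_le _
    by_cases hbt : b ⊆ qsupp t
    · rw [hht a ha (hab.trans hbt), hht b (ha.mono hab) hbt]
      exact htm a b hab hbt
    by_cases hbs : b ⊆ qsupp s
    · rw [hhs a ha (hab.trans hbs), hhs b (ha.mono hab) hbs]
      exact hsm a b hab hbs
    exact (hle a).trans (hhM b hbt hbs).ge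
  · intro a hau
    rcases a.eq_empty_or_nonempty with rfl | ha
    · exact fun _ _ _ hx => absurd hx (Set.notMem_empty _)
    by_cases hat : a ⊆ qsupp t
    · rw [hht a ha hat]
      exact (hti a hat).congr fun x hx => hut x (hat hx)
    by_cases has : a ⊆ qsupp s
    · rw [hhs a ha has]
      exact (hsi a has).congr fun x hx => hus x (has hx)
    rw [hhM a hat has]
    refine mInj_of_length_le fun x hx => ?_
    have : (u x).length ≤ N := hN ⟨x, hau hx, rfl⟩
    omega
  · exact hsupp ▸ Set.subset_union_left
  · exact fun x hx => (hut x hx).symm ▸ List.prefix_rfl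
  · intro a hat
    rcases a.eq_empty_or_nonempty with rfl | ha
    · exact hh0 ▸ Nat.zero_le _
    exact (hht a ha hat).le
  · exact hsupp ▸ Set.subset_union_right
  · exact fun x hx => (hus x hx).symm ▸ List.prefix_rfl
  · intro a has
    rcases a.eq_empty_or_nonempty with rfl | ha
    · exact hh0 ▸ Nat.zero_le _
    exact (hhs a ha has).le
end

section
/- For any finite sets E, S ⊆ κ×ℕ there exists π ∈ ℋ such that π fixes E pointwise and π''(S \ E) is disjoint from S ∪ E. -/
/-!
Context: `ℋ` is the group of permutations `π` of `κ×ℕ` (κ an infinite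
cardinal, represented by a type `K`) of the form `π(α,n) = (α, π_α(n))` for a
family `(π_α)` of permutations of `ℕ`.
-/

/-- Membership in the group `ℋ`: `π` has the form `π(α,n) = (α, π_α(n))`. -/
def InH (K : Type*) (π : Equiv.Perm (K × ℕ)) : Prop :=
  ∃ pa : K → Equiv.Perm ℕ, ∀ x : K × ℕ, π x = (x.1, pa x.1 x.2)

/-- Some permutation of `ℕ` shifts by `N` every `n < N` satisfying `p` and fixes every
other `n < N`. -/
theorem exists_perm_shift (N : ℕ) (p : ℕ → Prop) :
    ∃ f : Equiv.Perm ℕ, (∀ n < N, p n → f n = n + N) ∧ ∀ n < N, ¬ p n → f n = n := by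
  classical
  let g : ℕ → ℕ := fun n =>
    if n < N then (if p n then n + N else n)
    else if n < 2 * N ∧ p (n - N) then n - N else n
  have hg : Function.Involutive g := by
    intro n
    by_cases h1 : n < N
    · by_cases h2 : p n
      · have h3 : n + N < 2 * N := by omega
        simp [g, h1, h2, h3]
      · simp [g, h1, h2]
    · by_cases h2 : n < 2 * N ∧ p (n - N)
      · have h3 : n - N < N := by omega
        have h4 : n - N + N = n := by omega
        simp [g, h1, h2, h3, h4]
      · simp only [g, h1, h2, if_false]
  refine ⟨hg.toPerm, fun n h1 h2 => ?_, fun n h1 h2 => ?_⟩ <;> simp [g, h1, h2]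

/-- for any finite `E, S ⊆ κ×ℕ` there is `π ∈ ℋ` fixing `E`
pointwise with `π''(S \ E)` disjoint from `S ∪ E`. -/
theorem H_moves_off_finite_set (K : Type*)
    (hK : Cardinal.aleph0 ≤ Cardinal.mk K)
    (E S : Finset (K × ℕ)) :
    ∃ π : Equiv.Perm (K × ℕ), InH K π ∧ (∀ x ∈ E, π x = x) ∧
      Disjoint ((π : K × ℕ → K × ℕ) '' ((S : Set (K × ℕ)) \ (E : Set (K × ℕ))))
        ((S : Set (K × ℕ)) ∪ (E : Set (K × ℕ))) := by
  classical
  obtain ⟨N, hN⟩ : ∃ N, ∀ x ∈ S ∪ E, x.2 < N :=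
    ⟨(S ∪ E).sup Prod.snd + 1, fun x hx => Nat.lt_succ_of_le (Finset.le_sup (f := Prod.snd) hx)⟩
  choose f hmove hfix using fun a : K => exists_perm_shift N fun n => (a, n) ∉ E
  refine ⟨Equiv.prodShear (Equiv.refl K) f, ⟨f, fun x => rfl⟩, fun x hx => ?_, ?_⟩
  · exact Prod.ext rfl (hfix x.1 x.2 (hN x (Finset.mem_union_right S hx)) (not_not_intro hx))
  · rw [Set.disjoint_left]
    rintro _ ⟨x, ⟨hxS, hxE⟩, rfl⟩ hy
    have h := hN _ (Finset.mem_union.2 hy)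
    have h_move := hmove x.1 x.2 (hN x (Finset.mem_union_left E hxS)) hxE
    simp only [Equiv.prodShear_apply, h_move] at h
    omega
end
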